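/- Assume d(x,y) > 0 for all (x,y), and assume there are functions κ^{e'}_min, κ^{e'}_max on (x_L,x_R) with 0 ≤ κ^{e'}_min(x) ≤ e(x,y)/d(x,y) ≤ κ^{e'}_max(x) < ∞ for every (x,y). Assume that for each x the function y ↦ e(x,y)/d(x,y) is convex or concave on (y_L,y_R), and set κ^{e'}(x) = κ^{e'}_min(x) in the convex case and κ^{e'}(x) = κ^{e'}_max(x) in the concave case. If κ^{e'}(x) − √2·(κ^{e'}_max(x) − κ^{e'}_min(x))/ς_β ≥ 0 for every x, then D⁻¹ is symmetric positive definite and the symmetric part of D⁻¹·A, namely (D⁻¹·A + (D⁻¹·A)ᵀ)/2, is negative semidefinite. -/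

import Mathlib

open Matrix Kronecker

/-- The Grünwald–Letnikov coefficients `g_k^{(γ)}`. -/
noncomputable def gcoef (γ : ℝ) : ℕ → ℝ
  | 0 => 1
  | (k+1) => (1 - (γ + 1) / (k + 1 : ℕ)) * gcoef γ k

/-- The WSGD coefficients `w_k^{(γ)}`. -/
noncomputable def wcoef (γ : ℝ) : ℕ → ℝ
  | 0 => γ / 2 * gcoef γ 0
  | (k+1) => γ / 2 * gcoef γ (k+1) + (2 - γ) / 2 * gcoef γ k

/-- The `m × m` lower-Hessenberg Toeplitz matrix `G_γ`. -/
noncomputable def Gmat (γ : ℝ) (m : ℕ) : Matrix (Fin m) (Fin m) ℝ :=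
  Matrix.of fun i j => if (j : ℕ) ≤ (i : ℕ) + 1 then wcoef γ ((i : ℕ) + 1 - (j : ℕ)) else 0


lemma succ_mul_gcoef_succ (γ : ℝ) (k : ℕ) :
    ((k : ℝ) + 1) * gcoef γ (k + 1) = (k - γ) * gcoef γ k := by
  rw [gcoef]
  push_cast
  field_simp
  ring

lemma gcoef_nonneg {γ : ℝ} (hγ : γ ∈ Set.Ioo (1 : ℝ) 2) (k : ℕ) : 0 ≤ gcoef γ (k + 2) := by
  obtain ⟨h1, h2⟩ := hγ
  induction k with
  | zero =>
    simp only [gcoef]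
    norm_num
    nlinarith
  | succ k ih =>
    have h := succ_mul_gcoef_succ γ (k + 2)
    push_cast at h
    have hk : (0 : ℝ) ≤ k := k.cast_nonneg
    have : 0 ≤ ((k : ℝ) + 2 + 1) * gcoef γ (k + 2 + 1) := by
      rw [h]
      exact mul_nonneg (by linarith) ih
    exact nonneg_of_mul_nonneg_right this (by positivity)

lemma mul_sum_gcoef (γ : ℝ) (n : ℕ) :
    γ * ∑ k ∈ Finset.range (n + 1), gcoef γ k = -((n + 1) * gcoef γ (n + 1)) := by
  induction n with
  | zero => simp [gcoef]
  | succ n ih =>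
    rw [Finset.sum_range_succ, mul_add, ih]
    have h := succ_mul_gcoef_succ γ (n + 1)
    push_cast at h ⊢
    linarith

lemma sum_gcoef_nonpos {γ : ℝ} (hγ : γ ∈ Set.Ioo (1 : ℝ) 2) (n : ℕ) :
    ∑ k ∈ Finset.range (n + 2), gcoef γ k ≤ 0 := by
  have h := mul_sum_gcoef γ (n + 1)
  have hn := gcoef_nonneg hγ n
  have : 0 ≤ ((n + 1 : ℕ) + 1 : ℝ) * gcoef γ (n + 2) := by positivity
  have h1 := hγ.1
  by_contra! hpos
  nlinarith [mul_pos (by linarith : 0 < γ) hpos]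

lemma summable_gcoef {γ : ℝ} (hγ : γ ∈ Set.Ioo (1 : ℝ) 2) : Summable (gcoef γ) := by
  rw [← summable_nat_add_iff 2]
  refine summable_of_sum_range_le (c := γ - 1) (fun n => gcoef_nonneg hγ n) fun n => ?_
  have h := sum_gcoef_nonpos hγ n
  rw [Finset.sum_range_succ', Finset.sum_range_succ'] at h
  simp only [gcoef] at h ⊢
  norm_num at h ⊢
  linarith

lemma summable_wcoef {γ : ℝ} (hγ : γ ∈ Set.Ioo (1 : ℝ) 2) : Summable (wcoef γ) := by
  rw [← summable_nat_add_iff 1]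
  have hs := summable_gcoef hγ
  exact (((summable_nat_add_iff 1).2 hs).mul_left _).add (hs.mul_left _)

lemma sum_wcoef_nonpos {γ : ℝ} (hγ : γ ∈ Set.Ioo (1 : ℝ) 2) (n : ℕ) :
    ∑ k ∈ Finset.range (n + 3), wcoef γ k ≤ 0 := by
  have h : ∑ k ∈ Finset.range (n + 3), wcoef γ k =
      γ / 2 * ∑ k ∈ Finset.range (n + 3), gcoef γ k +
        (2 - γ) / 2 * ∑ k ∈ Finset.range (n + 2), gcoef γ k := by
    rw [Finset.sum_range_succ', Finset.sum_range_succ' (gcoef γ) (n + 2), Finset.mul_sum, mul_add,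
      Finset.mul_sum]
    simp only [wcoef, Finset.sum_add_distrib]
    ring
  have h1 := sum_gcoef_nonpos hγ n
  have h2 := sum_gcoef_nonpos hγ (n + 1)
  rw [h]
  nlinarith [hγ.1, hγ.2]

lemma wcoef_nonneg {γ : ℝ} (hγ : γ ∈ Set.Ioo (1 : ℝ) 2) (k : ℕ) : 0 ≤ wcoef γ (k + 3) := by
  have h1 := gcoef_nonneg hγ (k + 1)
  have h2 := gcoef_nonneg hγ k
  obtain ⟨h3, h4⟩ := hγ
  exact add_nonneg (mul_nonneg (by linarith) h1) (mul_nonneg (by linarith) h2)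

lemma wcoef_zero_add_two_nonneg {γ : ℝ} (hγ : γ ∈ Set.Ioo (1 : ℝ) 2) :
    0 ≤ wcoef γ 0 + wcoef γ 2 := by
  obtain ⟨h1, h2⟩ := hγ
  have : wcoef γ 0 + wcoef γ 2 = γ * (γ - 1) * (γ + 2) / 4 := by
    simp only [wcoef, gcoef]
    push_cast
    ring
  rw [this]
  have := sub_pos.2 h1
  positivity

lemma gcoef_eq_choose (γ : ℝ) (k : ℕ) :
    (gcoef γ k : ℂ) = (-1) ^ k * Ring.choose (γ : ℂ) k := by
  induction k with
  | zero => simp [gcoef]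
  | succ k ih =>
    have h : ((k : ℂ) + 1) * Ring.choose (γ : ℂ) (k + 1) = (γ - k) * Ring.choose (γ : ℂ) k := by
      have h1 := Ring.descPochhammer_eq_factorial_smul_choose (γ : ℂ) (k + 1)
      rw [descPochhammer_succ_right, Polynomial.smeval_mul,
        Ring.descPochhammer_eq_factorial_smul_choose] at h1
      simp only [Polynomial.smeval_sub, Polynomial.smeval_X, Polynomial.smeval_natCast,
        nsmul_eq_mul, Nat.factorial_succ, pow_one, pow_zero, mul_one] at h1
      push_cast at h1
      have hk : (k.factorial : ℂ) ≠ 0 := by exact_mod_cast k.factorial_ne_zero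
      apply mul_left_cancel₀ hk
      linear_combination -h1
    have hg : ((k : ℂ) + 1) * (gcoef γ (k + 1) : ℂ) = (k - γ) * gcoef γ k := by
      exact_mod_cast succ_mul_gcoef_succ γ k
    have hk : (k : ℂ) + 1 ≠ 0 := by exact_mod_cast k.succ_ne_zero
    apply mul_left_cancel₀ hk
    rw [hg, ih, pow_succ]
    linear_combination (-1) ^ k * h

lemma hasSum_gcoef_mul_pow_of_norm_lt (γ : ℝ) {z : ℂ} (hz : ‖z‖ < 1) :
    HasSum (fun k => (gcoef γ k : ℂ) * z ^ k) ((1 - z) ^ (γ : ℂ)) := by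
  have h := (Complex.one_add_cpow_hasFPowerSeriesOnBall_zero (a := (γ : ℂ))).hasSum
    (y := -z) (by simpa [Metric.mem_eball, edist_zero_right, ← ofReal_norm] using hz)
  rw [zero_add, ← sub_eq_add_neg] at h
  have hcoef : (fun k => (gcoef γ k : ℂ) * z ^ k) =
      fun k => binomialSeries ℂ (γ : ℂ) k fun _ => -z := by
    ext k
    rw [gcoef_eq_choose, binomialSeries_apply]
    simp only [List.ofFn_const, List.prod_replicate, smul_eq_mul]
    rw [neg_pow z]
    ring
  rw [hcoef]
  exact h

open Filter Topology in
lemma tsum_gcoef_mul_pow {γ : ℝ} (hγ : γ ∈ Set.Ioo (1 : ℝ) 2) {z : ℂ} (hz : ‖z‖ = 1)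
    (hz1 : z ≠ 1) : ∑' k, (gcoef γ k : ℂ) * z ^ k = (1 - z) ^ (γ : ℂ) := by
  have hre : z.re < 1 := by
    refine lt_of_le_of_ne (hz ▸ Complex.re_le_norm z) fun h => hz1 ?_
    have := Complex.sq_norm z
    rw [Complex.normSq_apply, hz, h] at this
    exact Complex.ext h (by simpa using (by linarith : z.im * z.im = 0))
  have hnorm : ∀ r ∈ Set.Ioo (0 : ℝ) 1, ‖(r : ℂ) * z‖ < 1 := by
    intro r hr
    simpa [hz, abs_of_pos hr.1] using hr.2
  have hmem : Set.Ioo (0 : ℝ) 1 ∈ 𝓝[<] (1 : ℝ) := Ioo_mem_nhdsLT one_pos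
  have hlim : Tendsto (fun r : ℝ => (r : ℂ) * z) (𝓝[<] 1) (𝓝 z) := by
    have : Continuous fun r : ℝ => (r : ℂ) * z := by fun_prop
    simpa using (this.tendsto 1).mono_left nhdsWithin_le_nhds
  have h1 : Tendsto (fun r : ℝ => ∑' k, (gcoef γ k : ℂ) * ((r : ℂ) * z) ^ k) (𝓝[<] 1)
      (𝓝 (∑' k, (gcoef γ k : ℂ) * z ^ k)) := by
    refine tendsto_tsum_of_dominated_convergence (summable_gcoef hγ).abs
      (fun k => (hlim.pow k).const_mul _) ?_
    filter_upwards [hmem] with r hr k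
    rw [norm_mul, norm_pow, Complex.norm_real, Real.norm_eq_abs]
    exact mul_le_of_le_one_right (abs_nonneg _) (pow_le_one₀ (norm_nonneg _) (hnorm r hr).le)
  have h2 : Tendsto (fun r : ℝ => (1 - (r : ℂ) * z) ^ (γ : ℂ)) (𝓝[<] 1)
      (𝓝 ((1 - z) ^ (γ : ℂ))) :=
    (tendsto_const_nhds.sub hlim).cpow tendsto_const_nhds (Or.inl (by simpa using hre))
  refine tendsto_nhds_unique (h1.congr' ?_) h2
  filter_upwards [hmem] with r hr
  exact (hasSum_gcoef_mul_pow_of_norm_lt γ (hnorm r hr)).tsum_eq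

/-- The generating function `∑ w_k e^{i(k-1)θ}` of the Toeplitz matrices `Gmat γ m`. -/
noncomputable def wsymbol (γ θ : ℝ) : ℂ :=
  ∑' k : ℕ, (wcoef γ k : ℂ) * Complex.exp ((k - 1) * θ * Complex.I)

lemma mul_sin_le_mul_sin {p r θ : ℝ} (hr : 0 ≤ r) (hrp : r ≤ p) (hp : p ≤ 1) (hp0 : 0 < p)
    (hθ : θ ∈ Set.Icc 0 Real.pi) : r * Real.sin (p * θ) ≤ p * Real.sin (r * θ) := by
  obtain ⟨h0, h1⟩ := hθ
  have h := strictConcaveOn_sin_Icc.concaveOn.2 (⟨by positivity, by nlinarith⟩ : p * θ ∈ Set.Icc 0 Real.pi)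
    (⟨le_rfl, Real.pi_pos.le⟩ : (0 : ℝ) ∈ Set.Icc 0 Real.pi) (by positivity : 0 ≤ r / p)
    (by rw [sub_nonneg, div_le_one hp0]; exact hrp : 0 ≤ 1 - r / p) (by ring)
  simp only [smul_eq_mul, Real.sin_zero, mul_zero, add_zero] at h
  rw [show r / p * (p * θ) = r * θ by field_simp, div_mul_eq_mul_div, div_le_iff₀ hp0] at h
  linarith

lemma cos_mul_sqrt_le {a b δ : ℝ} (hs : 0 < Real.sin δ) (hc : 0 ≤ Real.cos δ) (hb : 0 ≤ b)
    (h : b * Real.cos δ ≤ a * Real.sin δ) : Real.cos δ * Real.sqrt (a ^ 2 + b ^ 2) ≤ a := by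
  have h0 : 0 ≤ b * Real.cos δ := by positivity
  have ha : 0 ≤ a := nonneg_of_mul_nonneg_left (h0.trans h) hs
  rw [← pow_le_pow_iff_left₀ (by positivity) ha two_ne_zero, mul_pow, Real.sq_sqrt (by positivity)]
  have h2 := pow_le_pow_left₀ h0 h 2
  nlinarith [Real.sin_sq_add_cos_sq δ]

lemma abs_cos_eq {γ : ℝ} (hγ : γ ∈ Set.Ioo (1 : ℝ) 2) :
    |Real.cos (γ * Real.pi / 2)| = Real.cos ((1 - γ / 2) * Real.pi) := by
  obtain ⟨h1, h2⟩ := hγ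
  have hπ := Real.pi_pos
  rw [show (1 - γ / 2) * Real.pi = Real.pi - γ * Real.pi / 2 by ring, Real.cos_pi_sub,
    abs_of_nonpos]
  exact Real.cos_nonpos_of_pi_div_two_le_of_le (by nlinarith) (by nlinarith)

lemma abs_cos_pos {γ : ℝ} (hγ : γ ∈ Set.Ioo (1 : ℝ) 2) :
    0 < |Real.cos (γ * Real.pi / 2)| := by
  rw [abs_cos_eq hγ]
  have hπ := Real.pi_pos
  exact Real.cos_pos_of_mem_Ioo ⟨by nlinarith [hγ.2], by nlinarith [hγ.1]⟩

lemma wsymbol_eq_mul_tsum {γ : ℝ} (hγ : γ ∈ Set.Ioo (1 : ℝ) 2) (θ : ℝ) :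
    wsymbol γ θ = ((γ / 2 : ℝ) * Complex.exp (-θ * Complex.I) + (1 - γ / 2 : ℝ)) *
      ∑' k : ℕ, (gcoef γ k : ℂ) * Complex.exp (θ * Complex.I) ^ k := by
  have hz : ‖Complex.exp (θ * Complex.I)‖ = 1 := Complex.norm_exp_ofReal_mul_I θ
  have hg : Summable fun k : ℕ => (gcoef γ k : ℂ) * Complex.exp (θ * Complex.I) ^ k := by
    refine Summable.of_norm ?_
    simpa [hz] using (summable_gcoef hγ).abs
  have hw : Summable fun k : ℕ => (wcoef γ k : ℂ) * Complex.exp ((k - 1) * θ * Complex.I) := by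
    refine Summable.of_norm ?_
    have h : ∀ k : ℕ, ‖Complex.exp ((k - 1) * θ * Complex.I)‖ = 1 := fun k => by
      have := Complex.norm_exp_ofReal_mul_I ((k - 1) * θ)
      push_cast at this
      exact this
    simpa [h] using (summable_wcoef hγ).abs
  have hexp : Complex.exp (-θ * Complex.I) * Complex.exp (θ * Complex.I) = 1 := by
    rw [← Complex.exp_add, neg_mul, neg_add_cancel, Complex.exp_zero]
  have hg1 := (summable_nat_add_iff 1).2 hg
  have hsplit := hg.tsum_eq_zero_add
  have key : ∀ k : ℕ, (wcoef γ (k + 1) : ℂ) * Complex.exp (((k + 1 : ℕ) - 1) * θ * Complex.I) =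
      (γ / 2 : ℝ) * Complex.exp (-θ * Complex.I) *
        ((gcoef γ (k + 1) : ℂ) * Complex.exp (θ * Complex.I) ^ (k + 1)) +
      (1 - γ / 2 : ℝ) * ((gcoef γ k : ℂ) * Complex.exp (θ * Complex.I) ^ k) := by
    intro k
    have : Complex.exp (((k + 1 : ℕ) - 1) * θ * Complex.I) = Complex.exp (θ * Complex.I) ^ k := by
      rw [← Complex.exp_nat_mul]
      push_cast
      ring_nf
    rw [this, wcoef, pow_succ]
    push_cast
    linear_combination -(γ / 2 * gcoef γ (k + 1) * Complex.exp (θ * Complex.I) ^ k : ℂ) * hexp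
  rw [wsymbol, hw.tsum_eq_zero_add]
  simp_rw [key]
  rw [(hg1.mul_left _).tsum_add (hg.mul_left _), tsum_mul_left, tsum_mul_left, add_mul,
    ← add_assoc]
  congr 1
  rw [hsplit]
  simp [wcoef, gcoef]
  ring

lemma one_sub_exp_cpow (γ : ℝ) {θ : ℝ} (hθ : θ ∈ Set.Ioo 0 (2 * Real.pi)) :
    (1 - Complex.exp (θ * Complex.I)) ^ (γ : ℂ) =
      (Real.exp (γ * Real.log (2 * Real.sin (θ / 2))) : ℝ) *
        Complex.exp ((γ / 2 * (θ - Real.pi) : ℝ) * Complex.I) := by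
  obtain ⟨h0, h1⟩ := hθ
  have hπ := Real.pi_pos
  have hs : 0 < 2 * Real.sin (θ / 2) :=
    mul_pos two_pos (Real.sin_pos_of_pos_of_lt_pi (by linarith) (by linarith))
  have hpolar : 1 - Complex.exp (θ * Complex.I) = Complex.exp
      ((Real.log (2 * Real.sin (θ / 2)) : ℝ) + ((θ - Real.pi) / 2 : ℝ) * Complex.I) := by
    rw [Complex.exp_add, ← Complex.ofReal_exp, Real.exp_log hs, Complex.exp_mul_I,
      Complex.exp_mul_I, ← Complex.ofReal_cos, ← Complex.ofReal_sin, ← Complex.ofReal_cos,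
      ← Complex.ofReal_sin,
      show (θ - Real.pi) / 2 = θ / 2 - Real.pi / 2 by ring, Real.cos_sub_pi_div_two,
      Real.sin_sub_pi_div_two]
    have hc : Real.cos θ = 1 - 2 * Real.sin (θ / 2) ^ 2 := by
      rw [← Real.cos_sq_add_sin_sq (θ / 2), show θ = 2 * (θ / 2) by ring, Real.cos_two_mul]
      ring_nf
      rw [Real.cos_sq']
      ring
    have hsin : Real.sin θ = 2 * Real.sin (θ / 2) * Real.cos (θ / 2) := by
      rw [← Real.sin_two_mul]
      ring_nf
    rw [hc, hsin]
    push_cast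
    ring
  rw [Complex.cpow_def_of_ne_zero (by rw [hpolar]; exact Complex.exp_ne_zero _), hpolar,
    Complex.log_exp, Complex.ofReal_exp, ← Complex.exp_add]
  · congr 1
    push_cast
    ring
  · simp
    linarith
  · simp
    linarith

lemma mul_norm_wsymbol_le_aux {γ : ℝ} (hγ : γ ∈ Set.Ioo (1 : ℝ) 2) {θ : ℝ}
    (hθ : θ ∈ Set.Ioc 0 Real.pi) :
    |Real.cos (γ * Real.pi / 2)| * ‖wsymbol γ θ‖ ≤ -(wsymbol γ θ).re := by
  have hπ := Real.pi_pos
  have hθ' : θ ∈ Set.Ioo 0 (2 * Real.pi) := ⟨hθ.1, by linarith [hθ.2]⟩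
  have hz1 : Complex.exp (θ * Complex.I) ≠ 1 := by
    intro h
    obtain ⟨n, hn⟩ := Complex.exp_eq_one_iff.1 h
    have h2 : θ = n * (2 * Real.pi) := by
      have := congrArg Complex.im hn
      simpa using this
    have h3 : (0 : ℝ) < n := by
      by_contra! h
      nlinarith [hθ.1]
    have h4 : (1 : ℝ) ≤ n := by exact_mod_cast (by exact_mod_cast h3 : (0 : ℤ) < n)
    nlinarith [hθ.2]
  obtain ⟨h1, h2⟩ := hγ
  set p := γ / 2 with hp
  set c := Real.exp (γ * Real.log (2 * Real.sin (θ / 2))) with hc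
  have hcpos : 0 < c := Real.exp_pos _
  have hsym : wsymbol γ θ = (c : ℂ) *
      -((p * Real.cos ((1 - p) * (Real.pi - θ)) - (1 - p) * Real.cos (p * (Real.pi - θ)) : ℝ) +
        (p * Real.sin ((1 - p) * (Real.pi - θ)) + (1 - p) * Real.sin (p * (Real.pi - θ)) : ℝ) *
          Complex.I) := by
    rw [wsymbol_eq_mul_tsum ⟨h1, h2⟩, tsum_gcoef_mul_pow ⟨h1, h2⟩
      (Complex.norm_exp_ofReal_mul_I θ) hz1, one_sub_exp_cpow γ hθ', ← hp, ← hc]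
    have e1 : Complex.exp (-θ * Complex.I) * Complex.exp ((p * (θ - Real.pi) : ℝ) * Complex.I) =
        -((Real.cos ((1 - p) * (Real.pi - θ)) : ℝ) +
          (Real.sin ((1 - p) * (Real.pi - θ)) : ℝ) * Complex.I) := by
      rw [← Complex.exp_add, show -(θ : ℂ) * Complex.I + (p * (θ - Real.pi) : ℝ) * Complex.I =
        (((1 - p) * (Real.pi - θ) - Real.pi : ℝ) : ℂ) * Complex.I by push_cast; ring,
        Complex.exp_mul_I, ← Complex.ofReal_cos, ← Complex.ofReal_sin, Real.cos_sub_pi,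
        Real.sin_sub_pi]
      push_cast
      ring
    have e2 : Complex.exp ((p * (θ - Real.pi) : ℝ) * Complex.I) =
        (Real.cos (p * (Real.pi - θ)) : ℝ) - (Real.sin (p * (Real.pi - θ)) : ℝ) * Complex.I := by
      rw [show p * (θ - Real.pi) = -(p * (Real.pi - θ)) by ring, Complex.exp_mul_I,
        ← Complex.ofReal_cos, ← Complex.ofReal_sin, Real.cos_neg, Real.sin_neg]
      push_cast
      ring
    calc _ = (c : ℂ) * (p * (Complex.exp (-θ * Complex.I) *
              Complex.exp ((p * (θ - Real.pi) : ℝ) * Complex.I)) +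
            (1 - p : ℝ) * Complex.exp ((p * (θ - Real.pi) : ℝ) * Complex.I)) := by ring
      _ = _ := by
        rw [e1, e2]
        push_cast
        ring
  rw [hsym, norm_mul, norm_neg, Complex.norm_add_mul_I, Complex.norm_real, Real.norm_eq_abs,
    abs_of_pos hcpos, abs_cos_eq ⟨h1, h2⟩, ← hp, Complex.re_ofReal_mul, Complex.neg_re,
    mul_neg, neg_neg, mul_left_comm]
  refine mul_le_mul_of_nonneg_left ?_ hcpos.le
  have hp1 : 1 / 2 < p := by rw [hp]; linarith
  have hp2 : p < 1 := by rw [hp]; linarith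
  refine (cos_mul_sqrt_le ?_ ?_ ?_ ?_).trans
    (by rw [Complex.add_re, Complex.re_ofReal_mul, Complex.I_re, Complex.ofReal_re, mul_zero,
      add_zero])
  · exact Real.sin_pos_of_pos_of_lt_pi (by nlinarith) (by nlinarith)
  · exact Real.cos_nonneg_of_neg_pi_div_two_le_of_le (by nlinarith) (by nlinarith)
  · have ht0 : 0 ≤ Real.pi - θ := by linarith [hθ.2]
    have ht1 : Real.pi - θ ≤ Real.pi := by linarith [hθ.1]
    have s1 : 0 ≤ Real.sin ((1 - p) * (Real.pi - θ)) :=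
      Real.sin_nonneg_of_nonneg_of_le_pi (by nlinarith) (by nlinarith)
    have s2 : 0 ≤ Real.sin (p * (Real.pi - θ)) :=
      Real.sin_nonneg_of_nonneg_of_le_pi (by nlinarith) (by nlinarith)
    have : 0 ≤ 1 - p := by linarith
    positivity
  · have h := mul_sin_le_mul_sin (p := p) (r := 1 - p) (by linarith) (by linarith) hp2.le
      (by linarith) ⟨hθ.1.le, hθ.2⟩
    have e1 : Real.sin ((1 - p) * θ) = Real.sin ((1 - p) * Real.pi) *
        Real.cos ((1 - p) * (Real.pi - θ)) - Real.cos ((1 - p) * Real.pi) *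
        Real.sin ((1 - p) * (Real.pi - θ)) := by
      rw [← Real.sin_sub]
      ring_nf
    have e2 : Real.sin (p * θ) = Real.sin (p * (Real.pi - θ)) * Real.cos ((1 - p) * Real.pi) +
        Real.cos (p * (Real.pi - θ)) * Real.sin ((1 - p) * Real.pi) := by
      rw [← Real.sin_add, ← Real.sin_pi_sub]
      ring_nf
    rw [e1, e2] at h
    linarith

lemma wsymbol_two_pi_sub (γ θ : ℝ) :
    wsymbol γ (2 * Real.pi - θ) = starRingEnd ℂ (wsymbol γ θ) := by
  rw [wsymbol, wsymbol, Complex.conj_tsum]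
  refine tsum_congr fun k => ?_
  rw [map_mul, Complex.conj_ofReal, ← Complex.exp_conj]
  congr 1
  rw [Complex.exp_eq_exp_iff_exists_int]
  refine ⟨k - 1, ?_⟩
  simp
  ring

lemma mul_norm_wsymbol_le {γ : ℝ} (hγ : γ ∈ Set.Ioo (1 : ℝ) 2) {θ : ℝ}
    (hθ : θ ∈ Set.Ioo 0 (2 * Real.pi)) :
    |Real.cos (γ * Real.pi / 2)| * ‖wsymbol γ θ‖ ≤ -(wsymbol γ θ).re := by
  rcases le_total θ Real.pi with h | h
  · exact mul_norm_wsymbol_le_aux hγ ⟨hθ.1, h⟩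
  · have := mul_norm_wsymbol_le_aux hγ (θ := 2 * Real.pi - θ)
      ⟨by linarith [hθ.2], by linarith⟩
    simpa [wsymbol_two_pi_sub] using this

lemma integral_exp_int_mul (n : ℤ) :
    ∫ θ in (0 : ℝ)..(2 * Real.pi), Complex.exp (n * Complex.I * θ) =
      if n = 0 then (2 * Real.pi : ℂ) else 0 := by
  split_ifs with h
  · simp [h]
  · have hn : (n : ℂ) * Complex.I ≠ 0 := by simp [h]
    rw [integral_exp_mul_complex hn, div_eq_zero_iff, sub_eq_zero]
    left
    rw [Complex.exp_eq_exp_iff_exists_int]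
    refine ⟨n, ?_⟩
    push_cast
    ring

lemma norm_wcoef_mul_exp (γ θ : ℝ) (k : ℕ) :
    ‖(wcoef γ k : ℂ) * Complex.exp ((k - 1) * θ * Complex.I)‖ = |wcoef γ k| := by
  have := Complex.norm_exp_ofReal_mul_I ((k - 1) * θ)
  push_cast at this
  rw [norm_mul, this, mul_one, Complex.norm_real, Real.norm_eq_abs]

lemma continuous_wsymbol {γ : ℝ} (hγ : γ ∈ Set.Ioo (1 : ℝ) 2) : Continuous (wsymbol γ) :=
  continuous_tsum (fun k => by fun_prop) (summable_wcoef hγ).abs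
    fun k θ => (norm_wcoef_mul_exp γ θ k).le

lemma integral_wsymbol_mul_exp {γ : ℝ} (hγ : γ ∈ Set.Ioo (1 : ℝ) 2) {m : ℕ} (i j : Fin m) :
    ∫ θ in (0 : ℝ)..(2 * Real.pi), wsymbol γ θ *
      Complex.exp (((j : ℕ) - (i : ℕ) : ℤ) * Complex.I * θ) = 2 * Real.pi * Gmat γ m i j := by
  have hs := (summable_wcoef hγ).abs
  have hnorm : ∀ (n : ℤ) (θ : ℝ), ‖Complex.exp (n * Complex.I * θ)‖ = 1 := fun n θ => by
    have := Complex.norm_exp_ofReal_mul_I (n * θ)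
    push_cast at this
    rw [mul_right_comm, this]
  have h : HasSum (fun k : ℕ => ∫ θ in (0 : ℝ)..(2 * Real.pi),
      (wcoef γ k : ℂ) * Complex.exp ((k - 1) * θ * Complex.I) *
        Complex.exp (((j : ℕ) - (i : ℕ) : ℤ) * Complex.I * θ))
      (∫ θ in (0 : ℝ)..(2 * Real.pi), wsymbol γ θ *
        Complex.exp (((j : ℕ) - (i : ℕ) : ℤ) * Complex.I * θ)) := by
    refine intervalIntegral.hasSum_integral_of_dominated_convergence
      (fun k _ => |wcoef γ k|) (fun k => ?_) (fun k => ?_) ?_ ?_ ?_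
    · exact Continuous.aestronglyMeasurable (by fun_prop)
    · exact Filter.Eventually.of_forall fun θ _ => by
        rw [norm_mul, norm_wcoef_mul_exp, hnorm, mul_one]
    · exact Filter.Eventually.of_forall fun θ _ => hs
    · exact continuous_const.intervalIntegrable _ _
    · refine Filter.Eventually.of_forall fun θ _ => HasSum.mul_right _ ?_
      refine Summable.hasSum (Summable.of_norm ?_)
      simpa only [norm_wcoef_mul_exp] using hs
  have hterm : ∀ k : ℕ, ∫ θ in (0 : ℝ)..(2 * Real.pi),
      (wcoef γ k : ℂ) * Complex.exp ((k - 1) * θ * Complex.I) *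
        Complex.exp (((j : ℕ) - (i : ℕ) : ℤ) * Complex.I * θ) =
      if k + (j : ℕ) = i + 1 then (wcoef γ k : ℂ) * (2 * Real.pi) else 0 := by
    intro k
    have : ∀ θ : ℝ, (wcoef γ k : ℂ) * Complex.exp ((k - 1) * θ * Complex.I) *
        Complex.exp (((j : ℕ) - (i : ℕ) : ℤ) * Complex.I * θ) = (wcoef γ k : ℂ) *
          Complex.exp (((k : ℤ) - 1 + ((j : ℕ) - (i : ℕ) : ℤ) : ℤ) * Complex.I * θ) := by
      intro θ
      rw [mul_assoc, ← Complex.exp_add]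
      push_cast
      ring_nf
    simp_rw [this]
    rw [intervalIntegral.integral_const_mul, integral_exp_int_mul, mul_ite, mul_zero]
    exact if_congr (by omega) rfl rfl
  simp_rw [hterm] at h
  by_cases hij : (j : ℕ) ≤ i + 1
  · refine h.unique ?_
    convert hasSum_ite_eq ((i : ℕ) + 1 - j) (2 * Real.pi * Gmat γ m i j : ℂ) using 2 with k
    by_cases hk : k + (j : ℕ) = i + 1
    · have hk' : k = (i : ℕ) + 1 - j := by omega
      rw [if_pos hk, if_pos hk', Gmat, Matrix.of_apply, if_pos hij, hk', mul_comm]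
    · rw [if_neg hk, if_neg (by omega)]
  · refine h.unique ?_
    rw [Gmat, Matrix.of_apply, if_neg hij, Complex.ofReal_zero, mul_zero]
    convert hasSum_zero using 2 with k
    rw [if_neg (by omega)]

/-- The trigonometric polynomial `∑ u_j e^{ijθ}`. -/
noncomputable def trigPoly {m : ℕ} (u : Fin m → ℝ) (θ : ℝ) : ℂ :=
  ∑ j, (u j : ℂ) * Complex.exp ((j : ℕ) * Complex.I * θ)

lemma continuous_trigPoly {m : ℕ} (u : Fin m → ℝ) : Continuous (trigPoly u) := by
  unfold trigPoly
  fun_prop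

/-- The bilinear form of the Toeplitz matrix `Gmat γ m`. -/
noncomputable def gForm (γ : ℝ) {m : ℕ} (v u : Fin m → ℝ) : ℝ :=
  ∑ i, ∑ j, v i * Gmat γ m i j * u j

lemma integral_wsymbol_mul_trigPoly {γ : ℝ} (hγ : γ ∈ Set.Ioo (1 : ℝ) 2) {m : ℕ}
    (v u : Fin m → ℝ) :
    ∫ θ in (0 : ℝ)..(2 * Real.pi),
      wsymbol γ θ * (starRingEnd ℂ (trigPoly v θ) * trigPoly u θ) =
      (2 * Real.pi * gForm γ v u : ℝ) := by
  have hc := continuous_wsymbol hγ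
  have hexp : ∀ θ, wsymbol γ θ * (starRingEnd ℂ (trigPoly v θ) * trigPoly u θ) =
      ∑ i, ∑ j, (v i * u j : ℂ) * (wsymbol γ θ *
        Complex.exp (((j : ℕ) - (i : ℕ) : ℤ) * Complex.I * θ)) := by
    intro θ
    simp only [trigPoly, map_sum]
    rw [Finset.sum_mul_sum, Finset.mul_sum]
    refine Finset.sum_congr rfl fun i _ => ?_
    rw [Finset.mul_sum]
    refine Finset.sum_congr rfl fun j _ => ?_
    rw [map_mul, Complex.conj_ofReal, ← Complex.exp_conj]
    have : Complex.exp (((j : ℕ) - (i : ℕ) : ℤ) * Complex.I * θ) =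
        Complex.exp (starRingEnd ℂ ((i : ℕ) * Complex.I * θ)) *
          Complex.exp ((j : ℕ) * Complex.I * θ) := by
      rw [← Complex.exp_add]
      simp
      ring_nf
    rw [this]
    ring
  simp_rw [hexp]
  rw [intervalIntegral.integral_finsetSum fun i _ =>
    Continuous.intervalIntegrable (by fun_prop) _ _]
  simp_rw [gForm, Finset.mul_sum, Complex.ofReal_sum]
  refine Finset.sum_congr rfl fun i _ => ?_
  rw [intervalIntegral.integral_finsetSum fun j _ =>
    Continuous.intervalIntegrable (by fun_prop) _ _]
  refine Finset.sum_congr rfl fun j _ => ?_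
  rw [intervalIntegral.integral_const_mul, integral_wsymbol_mul_exp hγ]
  push_cast
  ring

lemma integral_re_wsymbol_mul {γ : ℝ} (hγ : γ ∈ Set.Ioo (1 : ℝ) 2) {m : ℕ}
    (v u : Fin m → ℝ) :
    ∫ θ in (0 : ℝ)..(2 * Real.pi),
      (wsymbol γ θ * (starRingEnd ℂ (trigPoly v θ) * trigPoly u θ)).re =
      2 * Real.pi * gForm γ v u := by
  have hc := continuous_wsymbol hγ
  have hu := continuous_trigPoly u
  have hv := continuous_trigPoly v
  have hcont : Continuous fun θ =>
      wsymbol γ θ * (starRingEnd ℂ (trigPoly v θ) * trigPoly u θ) :=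
    hc.mul ((Complex.continuous_conj.comp hv).mul hu)
  have := Complex.reCLM.intervalIntegral_comp_comm
    (hcont.intervalIntegrable (μ := MeasureTheory.volume) 0 (2 * Real.pi))
  simp only [Complex.reCLM_apply] at this
  rw [this, integral_wsymbol_mul_trigPoly hγ, Complex.ofReal_re]

lemma two_mul_gForm_le {γ : ℝ} (hγ : γ ∈ Set.Ioo (1 : ℝ) 2) {m : ℕ} (v u : Fin m → ℝ)
    {t : ℝ} (ht : 0 < t) :
    |Real.cos (γ * Real.pi / 2)| * (2 * gForm γ v u) ≤ -(t * gForm γ v v + t⁻¹ * gForm γ u u) := by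
  have hc := continuous_wsymbol hγ
  have hcont : ∀ v u : Fin m → ℝ, Continuous fun θ =>
      (wsymbol γ θ * (starRingEnd ℂ (trigPoly v θ) * trigPoly u θ)).re := fun v u =>
    Complex.continuous_re.comp (hc.mul
      ((Complex.continuous_conj.comp (continuous_trigPoly v)).mul (continuous_trigPoly u)))
  have hint : ∀ v u : Fin m → ℝ, IntervalIntegrable (fun θ =>
      (wsymbol γ θ * (starRingEnd ℂ (trigPoly v θ) * trigPoly u θ)).re) MeasureTheory.volume 0
        (2 * Real.pi) := fun v u => (hcont v u).intervalIntegrable _ _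
  have hmono := intervalIntegral.integral_mono_on_of_le_Ioo (by positivity)
    ((hint v u).const_mul (|Real.cos (γ * Real.pi / 2)| * 2))
    (((hint v v).const_mul t).add ((hint u u).const_mul t⁻¹)).neg fun θ hθ => by
      have hsq : ∀ z : ℂ, (wsymbol γ θ * (starRingEnd ℂ z * z)).re =
          (wsymbol γ θ).re * ‖z‖ ^ 2 := fun z => by
        rw [← Complex.normSq_eq_conj_mul_self, Complex.re_mul_ofReal, Complex.sq_norm]
      have hle : (wsymbol γ θ * (starRingEnd ℂ (trigPoly v θ) * trigPoly u θ)).re ≤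
          ‖wsymbol γ θ‖ * (‖trigPoly v θ‖ * ‖trigPoly u θ‖) := by
        refine (Complex.re_le_norm _).trans_eq ?_
        rw [norm_mul, norm_mul, RCLike.norm_conj]
      have hw := mul_norm_wsymbol_le hγ hθ
      set a := ‖trigPoly v θ‖
      set b := ‖trigPoly u θ‖
      have hab : 2 * (a * b) ≤ t * a ^ 2 + t⁻¹ * b ^ 2 := by
        have : t * a ^ 2 + t⁻¹ * b ^ 2 - 2 * (a * b) = t * (a - t⁻¹ * b) ^ 2 := by
          field_simp
          ring
        nlinarith [mul_nonneg ht.le (sq_nonneg (a - t⁻¹ * b))]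
      simp only [Pi.neg_apply, hsq]
      calc _ ≤ |Real.cos (γ * Real.pi / 2)| * 2 * (‖wsymbol γ θ‖ * (a * b)) := by gcongr
        _ = |Real.cos (γ * Real.pi / 2)| * ‖wsymbol γ θ‖ * (2 * (a * b)) := by ring
        _ ≤ -(wsymbol γ θ).re * (t * a ^ 2 + t⁻¹ * b ^ 2) :=
          mul_le_mul hw hab (by positivity) ((by positivity : (0 : ℝ) ≤ _).trans hw)
        _ = _ := by ring
  simp only [Pi.neg_apply] at hmono
  rw [intervalIntegral.integral_const_mul, intervalIntegral.integral_neg,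
    intervalIntegral.integral_add ((hint v v).const_mul t) ((hint u u).const_mul t⁻¹),
    intervalIntegral.integral_const_mul, intervalIntegral.integral_const_mul,
    integral_re_wsymbol_mul hγ, integral_re_wsymbol_mul hγ, integral_re_wsymbol_mul hγ] at hmono
  have hπ : 0 < 2 * Real.pi := by positivity
  refine le_of_mul_le_mul_left ?_ hπ
  linarith

lemma gForm_self_nonpos {γ : ℝ} (hγ : γ ∈ Set.Ioo (1 : ℝ) 2) {m : ℕ} (u : Fin m → ℝ) :
    gForm γ u u ≤ 0 := by
  have h := two_mul_gForm_le hγ 0 u one_pos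
  simp only [gForm, Pi.zero_apply, zero_mul, Finset.sum_const_zero, mul_zero, inv_one, one_mul,
    zero_add] at h ⊢
  linarith

lemma sum_mul_mul_nonneg {ι : Type*} [Fintype ι] (M : ι → ι → ℝ) (hM : ∀ i j, M i j = M j i)
    (hoff : ∀ i j, i ≠ j → M i j ≤ 0) (hrow : ∀ i, 0 ≤ ∑ j, M i j) (u : ι → ℝ) :
    0 ≤ ∑ i, ∑ j, M i j * (u i * u j) := by
  have h1 : ∑ i, ∑ j, M i j * u i ^ 2 ≤ ∑ i, ∑ j, M i j * (u i * u j) := by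
    have hswap : ∑ i, ∑ j, M i j * u i ^ 2 =
        ∑ i, ∑ j, M i j * ((u i ^ 2 + u j ^ 2) / 2) := by
      have : ∑ i, ∑ j, M i j * u j ^ 2 = ∑ i, ∑ j, M i j * u i ^ 2 := by
        rw [Finset.sum_comm]
        exact Finset.sum_congr rfl fun i _ => Finset.sum_congr rfl fun j _ => by rw [hM]
      have h2 : ∑ i, ∑ j, M i j * ((u i ^ 2 + u j ^ 2) / 2) =
          (∑ i, ∑ j, M i j * u i ^ 2 + ∑ i, ∑ j, M i j * u j ^ 2) / 2 := by
        simp_rw [← Finset.sum_add_distrib, Finset.sum_div]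
        exact Finset.sum_congr rfl fun i _ => Finset.sum_congr rfl fun j _ => by ring
      rw [h2, this]
      ring
    rw [hswap]
    refine Finset.sum_le_sum fun i _ => Finset.sum_le_sum fun j _ => ?_
    rcases eq_or_ne i j with rfl | hij
    · exact le_of_eq (by ring)
    · exact mul_le_mul_of_nonpos_left (by nlinarith [sq_nonneg (u i - u j)]) (hoff i j hij)
  refine le_trans (Finset.sum_nonneg fun i _ => ?_) h1
  rw [← Finset.sum_mul]
  exact mul_nonneg (hrow i) (sq_nonneg _)

/-- The entry of `Gmat γ m + (Gmat γ m)ᵀ` at distance `k + 1` from the diagonal. -/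
noncomputable def symCoef (γ : ℝ) (k : ℕ) : ℝ :=
  if k = 0 then wcoef γ 0 + wcoef γ 2 else wcoef γ (k + 2)

lemma symCoef_nonneg {γ : ℝ} (hγ : γ ∈ Set.Ioo (1 : ℝ) 2) (k : ℕ) : 0 ≤ symCoef γ k := by
  rcases k with _ | k
  · simpa [symCoef] using wcoef_zero_add_two_nonneg hγ
  · simpa [symCoef] using wcoef_nonneg hγ k

lemma sum_symCoef_le {γ : ℝ} (hγ : γ ∈ Set.Ioo (1 : ℝ) 2) (n : ℕ) :
    ∑ k ∈ Finset.range (n + 1), symCoef γ k ≤ -wcoef γ 1 := by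
  have h := sum_wcoef_nonpos hγ n
  rw [Finset.sum_range_succ', Finset.sum_range_succ', Finset.sum_range_succ'] at h
  rw [Finset.sum_range_succ']
  simp only [symCoef, Nat.add_eq_zero_iff, one_ne_zero, and_false, if_false, if_true]
  norm_num [add_assoc] at h ⊢
  linarith

lemma Gmat_self (γ : ℝ) {m : ℕ} (i : Fin m) : Gmat γ m i i = wcoef γ 1 := by
  simp [Gmat]

lemma Gmat_add_of_lt (γ : ℝ) {m : ℕ} {i j : Fin m} {k : ℕ} (h : (i : ℕ) + 1 + k = j) :
    Gmat γ m i j + Gmat γ m j i = symCoef γ k := by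
  simp only [Gmat, Matrix.of_apply, symCoef, ← h]
  rcases k with _ | k
  · simp [add_assoc]
  · rw [if_neg (by omega), if_pos (by omega), if_neg (by omega), zero_add]
    congr 1
    omega

/-- The entries of `Gmat γ m + (Gmat γ m)ᵀ` as a function of two natural numbers. -/
noncomputable def symEntry (γ : ℝ) (i j : ℕ) : ℝ :=
  if i = j then 2 * wcoef γ 1 else if i < j then symCoef γ (j - i - 1) else symCoef γ (i - j - 1)

lemma Gmat_add_swap (γ : ℝ) {m : ℕ} (i j : Fin m) :
    Gmat γ m i j + Gmat γ m j i = symEntry γ i j := by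
  rcases lt_trichotomy (i : ℕ) j with h | h | h
  · rw [symEntry, if_neg h.ne, if_pos h]
    exact Gmat_add_of_lt γ (by omega)
  · obtain rfl := Fin.ext h
    rw [symEntry, if_pos rfl, Gmat_self]
    ring
  · rw [symEntry, if_neg h.ne', if_neg h.not_gt, add_comm]
    exact Gmat_add_of_lt γ (by omega)

lemma sum_symEntry_mul (γ : ℝ) (F : ℕ → ℝ) {i m : ℕ} (hi : i < m) :
    ∑ j ∈ Finset.range m, symEntry γ i j * F j = 2 * wcoef γ 1 * F i +
      ∑ k ∈ Finset.range m, symCoef γ k * ((if k < i then F (i - 1 - k) else 0) +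
        if i + 1 + k < m then F (i + 1 + k) else 0) := by
  obtain ⟨n, rfl⟩ : ∃ n, m = i + 1 + n := ⟨m - (i + 1), by omega⟩
  rw [Finset.sum_range_add, Finset.sum_range_succ, ← Finset.sum_range_reflect]
  simp_rw [mul_add]
  rw [Finset.sum_add_distrib]
  have h1 : ∑ k ∈ Finset.range (i + 1 + n), symCoef γ k * (if k < i then F (i - 1 - k) else 0) =
      ∑ k ∈ Finset.range i, symEntry γ i (i - 1 - k) * F (i - 1 - k) := by
    symm
    refine Finset.sum_subset_zero_on_sdiff
      (Finset.range_subset_range.2 (by omega)) (fun k hk => ?_) fun k hk => ?_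
    · have : ¬ k < i := by simpa using (Finset.mem_sdiff.1 hk).2
      rw [if_neg this, mul_zero]
    · have hk := Finset.mem_range.1 hk
      rw [if_pos hk, symEntry, if_neg (by omega), if_neg (by omega)]
      congr 2
      omega
  have h2 : ∑ k ∈ Finset.range (i + 1 + n),
      symCoef γ k * (if i + 1 + k < i + 1 + n then F (i + 1 + k) else 0) =
      ∑ k ∈ Finset.range n, symEntry γ i (i + 1 + k) * F (i + 1 + k) := by
    symm
    refine Finset.sum_subset_zero_on_sdiff
      (Finset.range_subset_range.2 (by omega)) (fun k hk => ?_) fun k hk => ?_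
    · have : ¬ k < n := by simpa using (Finset.mem_sdiff.1 hk).2
      rw [if_neg (by omega), mul_zero]
    · have hk := Finset.mem_range.1 hk
      rw [if_pos (by omega), symEntry, if_neg (by omega), if_pos (by omega)]
      congr 2
      omega
  rw [h1, h2, symEntry, if_pos rfl]
  ring

lemma sum_symEntry_mul_nonpos {γ : ℝ} (hγ : γ ∈ Set.Ioo (1 : ℝ) 2) (F : ℕ → ℝ) {i m : ℕ}
    (hi : i < m) (h0 : 0 ≤ F i) (h2 : ∀ j < m, F j ≤ 2 * F i)
    (hmid : ∀ k ≤ i, i + k < m → F (i - k) + F (i + k) ≤ 2 * F i) :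
    ∑ j ∈ Finset.range m, symEntry γ i j * F j ≤ 0 := by
  rw [sum_symEntry_mul γ F hi]
  have hle : ∑ k ∈ Finset.range m, symCoef γ k * ((if k < i then F (i - 1 - k) else 0) +
        if i + 1 + k < m then F (i + 1 + k) else 0) ≤
      ∑ k ∈ Finset.range m, symCoef γ k * (2 * F i) := by
    refine Finset.sum_le_sum fun k _ => mul_le_mul_of_nonneg_left ?_ (symCoef_nonneg hγ k)
    split_ifs with h3 h4 h4
    · have := hmid (k + 1) (by omega) (by omega)
      rwa [show i - (k + 1) = i - 1 - k by omega, show i + (k + 1) = i + 1 + k by omega] at this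
    · simpa using h2 _ (by omega)
    · simpa using h2 _ h4
    · simpa using h0
  obtain ⟨n, rfl⟩ : ∃ n, m = n + 1 := ⟨m - 1, by omega⟩
  have hs := sum_symCoef_le hγ n
  rw [← Finset.sum_mul] at hle
  nlinarith

/-- Multiplication by a convex sequence with values in `[0, ω]` increases the quadratic form
of `-Gmat γ m` at most by the factor `2 * ω ^ 2`. -/
lemma neg_gForm_mul_le {γ : ℝ} (hγ : γ ∈ Set.Ioo (1 : ℝ) 2) {m : ℕ} (q : ℕ → ℝ) {ω : ℝ}
    (hq0 : ∀ j < m, 0 ≤ q j) (hqω : ∀ j < m, q j ≤ ω)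
    (hmid : ∀ i k, k ≤ i → i + k < m → 2 * q i ≤ q (i - k) + q (i + k)) (u : Fin m → ℝ) :
    -gForm γ (fun j => q j * u j) (fun j => q j * u j) ≤ 2 * ω ^ 2 * -gForm γ u u := by
  have hqq : ∀ i < m, ∀ j < m, q i * q j ≤ ω ^ 2 := fun i hi j hj => by
    rw [sq]
    exact mul_le_mul (hqω i hi) (hqω j hj) (hq0 j hj) ((hq0 i hi).trans (hqω i hi))
  have h := sum_mul_mul_nonneg
    (fun i j : Fin m => -(symEntry γ i j * (2 * ω ^ 2 - q i * q j)))
    (fun i j => by rw [← Gmat_add_swap, ← Gmat_add_swap]; ring)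
    (fun i j hij => by
      have hij' : (i : ℕ) ≠ j := fun h => hij (Fin.ext h)
      have h1 : 0 ≤ symEntry γ i j := by
        rw [symEntry, if_neg hij']
        split_ifs <;> exact symCoef_nonneg hγ _
      have h2 : 0 ≤ 2 * ω ^ 2 - q i * q j := by
        linarith [hqq i i.2 j j.2, sq_nonneg ω]
      exact neg_nonpos.2 (mul_nonneg h1 h2))
    (fun i => by
      rw [Finset.sum_neg_distrib, neg_nonneg,
        Fin.sum_univ_eq_sum_range fun j => symEntry γ i j * (2 * ω ^ 2 - q i * q j)]
      have hi := hqq i i.2 i i.2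
      refine sum_symEntry_mul_nonpos hγ _ i.2 ?_ (fun j hj => ?_) fun k hk hkm => ?_
      · linarith [sq_nonneg ω]
      · linarith [mul_nonneg (hq0 i i.2) (hq0 j hj)]
      · linarith [mul_le_mul_of_nonneg_left (hmid i k hk hkm) (hq0 i i.2)]) u
  have hsum : ∑ i : Fin m, ∑ j : Fin m,
      -(symEntry γ i j * (2 * ω ^ 2 - q i * q j)) * (u i * u j) =
      2 * (2 * ω ^ 2 * -gForm γ u u + gForm γ (fun j => q j * u j) (fun j => q j * u j)) := by
    have hT : ∀ T : Fin m → Fin m → ℝ, (∀ i j, T i j = T j i) →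
        ∑ i : Fin m, ∑ j : Fin m, symEntry γ i j * T i j =
          2 * ∑ i, ∑ j, Gmat γ m i j * T i j := by
      intro T hT
      simp_rw [← Gmat_add_swap (m := m), add_mul, Finset.sum_add_distrib]
      rw [two_mul]
      congr 1
      rw [Finset.sum_comm]
      exact Finset.sum_congr rfl fun i _ => Finset.sum_congr rfl fun j _ => by rw [hT]
    calc _ = ∑ i : Fin m, ∑ j : Fin m,
          symEntry γ i j * (-((2 * ω ^ 2 - q i * q j) * (u i * u j))) :=
          Finset.sum_congr rfl fun i _ => Finset.sum_congr rfl fun j _ => by ring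
      _ = _ := by
        rw [hT _ fun i j => by ring]
        simp only [gForm, ← Finset.sum_neg_distrib, Finset.mul_sum, ← Finset.sum_add_distrib]
        exact Finset.sum_congr rfl fun i _ => Finset.sum_congr rfl fun j _ => by ring
  rw [hsum] at h
  linarith

lemma mul_gForm_le {γ : ℝ} (hγ : γ ∈ Set.Ioo (1 : ℝ) 2) {m : ℕ} {v u : Fin m → ℝ} {ω : ℝ}
    (hω : 0 < ω) (h : -gForm γ v v ≤ 2 * ω ^ 2 * -gForm γ u u) :
    |Real.cos (γ * Real.pi / 2)| * gForm γ v u ≤ Real.sqrt 2 * ω * -gForm γ u u := by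
  have hs : 0 < Real.sqrt 2 * ω := by positivity
  have h1 := two_mul_gForm_le hγ v u (inv_pos.2 hs)
  have h2 : (Real.sqrt 2 * ω)⁻¹ * -gForm γ v v ≤ Real.sqrt 2 * ω * -gForm γ u u := by
    rw [inv_mul_le_iff₀ hs]
    refine h.trans_eq ?_
    rw [← Real.sq_sqrt (zero_le_two (α := ℝ))]
    simp only [Real.sqrt_sq (Real.sqrt_nonneg 2)]
    ring
  rw [inv_inv] at h1
  linarith

lemma gForm_add_mul_nonpos {γ : ℝ} (hγ : γ ∈ Set.Ioo (1 : ℝ) 2) {m : ℕ} (q : ℕ → ℝ)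
    {ω κ s : ℝ} (hs : s ^ 2 = 1) (hω : 0 ≤ ω)
    (hκ : 0 ≤ κ - Real.sqrt 2 * ω / |Real.cos (γ * Real.pi / 2)|)
    (hq0 : ∀ j < m, 0 ≤ q j) (hqω : ∀ j < m, q j ≤ ω)
    (hmid : ∀ i k, k ≤ i → i + k < m → 2 * q i ≤ q (i - k) + q (i + k)) (u : Fin m → ℝ) :
    gForm γ (fun j => (κ + s * q j) * u j) u ≤ 0 := by
  have hς := abs_cos_pos hγ
  have hu := gForm_self_nonpos hγ u
  have hsplit : gForm γ (fun j => (κ + s * q j) * u j) u =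
      κ * gForm γ u u + gForm γ (fun j => s * (q j * u j)) u := by
    simp only [gForm, Finset.mul_sum, ← Finset.sum_add_distrib]
    exact Finset.sum_congr rfl fun i _ => Finset.sum_congr rfl fun j _ => by ring
  have hκ' : Real.sqrt 2 * ω ≤ κ * |Real.cos (γ * Real.pi / 2)| := by
    rwa [sub_nonneg, div_le_iff₀ hς] at hκ
  have hmain : |Real.cos (γ * Real.pi / 2)| * gForm γ (fun j => s * (q j * u j)) u ≤
      Real.sqrt 2 * ω * -gForm γ u u := by
    rcases hω.eq_or_lt with rfl | hω
    · have : ∀ j : Fin m, q j = 0 := fun j => le_antisymm (hqω j j.2) (hq0 j j.2)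
      simp [gForm, this]
    · refine mul_gForm_le hγ hω (le_trans (le_of_eq ?_) (neg_gForm_mul_le hγ q hq0 hqω hmid u))
      simp only [gForm]
      refine congrArg _ (Finset.sum_congr rfl fun i _ => Finset.sum_congr rfl fun j _ => ?_)
      linear_combination (q i * u i * Gmat γ m i j * (q j * u j)) * hs
  rw [hsplit]
  refine nonpos_of_mul_nonpos_right ?_ hς
  nlinarith [mul_le_mul_of_nonneg_right hκ' (neg_nonneg.2 hu)]

lemma ConvexOn.two_mul_le_of_grid {f : ℝ → ℝ} {S : Set ℝ} (hf : ConvexOn ℝ S f) {a h : ℝ} {m : ℕ}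
    (hmem : ∀ j < m, a + ((j : ℝ) + 1) * h ∈ S) {i k : ℕ} (hk : k ≤ i) (hm : i + k < m) :
    2 * f (a + ((i : ℝ) + 1) * h) ≤
      f (a + (((i - k : ℕ) : ℝ) + 1) * h) + f (a + (((i + k : ℕ) : ℝ) + 1) * h) := by
  have := hf.2 (hmem (i - k) (by omega)) (hmem (i + k) hm) (by norm_num : (0 : ℝ) ≤ 1 / 2)
    (by norm_num : (0 : ℝ) ≤ 1 / 2) (by norm_num)
  simp only [smul_eq_mul] at this
  have hmidpt : 1 / 2 * (a + (((i - k : ℕ) : ℝ) + 1) * h) +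
      1 / 2 * (a + (((i + k : ℕ) : ℝ) + 1) * h) = a + ((i : ℝ) + 1) * h := by
    push_cast [Nat.cast_sub hk]
    ring
  rw [hmidpt] at this
  linarith

lemma gForm_convex_or_concave_nonpos {γ : ℝ} (hγ : γ ∈ Set.Ioo (1 : ℝ) 2) {f : ℝ → ℝ} {S : Set ℝ}
    {a h : ℝ} {m : ℕ} (hm : 0 < m) (hmem : ∀ j < m, a + ((j : ℝ) + 1) * h ∈ S)
    {κmin κmax κ : ℝ} (hbound : ∀ y ∈ S, κmin ≤ f y ∧ f y ≤ κmax)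
    (hκ : (ConvexOn ℝ S f ∧ κ = κmin) ∨ (ConcaveOn ℝ S f ∧ κ = κmax))
    (hcond : 0 ≤ κ - Real.sqrt 2 * (κmax - κmin) / |Real.cos (γ * Real.pi / 2)|)
    (u : Fin m → ℝ) :
    gForm γ (fun j => f (a + (((j : ℕ) : ℝ) + 1) * h) * u j) u ≤ 0 := by
  have hω : 0 ≤ κmax - κmin := by
    have := hbound _ (hmem 0 hm)
    linarith
  rcases hκ with ⟨hf, rfl⟩ | ⟨hf, rfl⟩
  · have := gForm_add_mul_nonpos hγ (fun j => f (a + ((j : ℝ) + 1) * h) - κ) (s := 1)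
      (by norm_num) hω hcond (fun j hj => sub_nonneg.2 (hbound _ (hmem j hj)).1)
      (fun j hj => sub_le_sub_right (hbound _ (hmem j hj)).2 _)
      (fun i k hk hkm => by linarith [hf.two_mul_le_of_grid hmem hk hkm]) u
    simpa using this
  · have := gForm_add_mul_nonpos hγ (fun j => κ - f (a + ((j : ℝ) + 1) * h)) (s := -1)
      (by norm_num) hω hcond (fun j hj => sub_nonneg.2 (hbound _ (hmem j hj)).2)
      (fun j hj => sub_le_sub_left (hbound _ (hmem j hj)).1 _)
      (fun i k hk hkm => by
        have := hf.neg.two_mul_le_of_grid hmem hk hkm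
        simp only [Pi.neg_apply] at this
        linarith) u
    simpa using this

lemma posSemidef_neg_symmetric_part {ι : Type*} [Fintype ι] {B : Matrix ι ι ℝ}
    (hB : ∀ x : ι → ℝ, x ⬝ᵥ B *ᵥ x ≤ 0) :
    (-(((1 : ℝ) / 2) • (B + Bᵀ))).PosSemidef := by
  refine Matrix.PosSemidef.of_dotProduct_mulVec_nonneg ?_ fun x => ?_
  · rw [Matrix.IsHermitian, Matrix.conjTranspose_eq_transpose_of_trivial]
    simp [add_comm]
  · have hT : x ⬝ᵥ Bᵀ *ᵥ x = x ⬝ᵥ B *ᵥ x := by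
      rw [Matrix.dotProduct_mulVec, Matrix.vecMul_transpose, dotProduct_comm]
    have := hB x
    simp only [star_trivial, Matrix.neg_mulVec, Matrix.smul_mulVec, Matrix.add_mulVec,
      dotProduct_neg, dotProduct_smul, dotProduct_add, hT, smul_eq_mul]
    linarith

lemma dotProduct_one_kronecker_mulVec (γ : ℝ) {m n : ℕ} (x : Fin n × Fin m → ℝ) :
    x ⬝ᵥ ((1 : Matrix (Fin n) (Fin n) ℝ) ⊗ₖ Gmat γ m) *ᵥ x =
      ∑ j, gForm γ (fun i => x (j, i)) (fun i => x (j, i)) := by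
  simp only [dotProduct, Matrix.mulVec, Matrix.kroneckerMap_apply, Fintype.sum_prod_type, gForm,
    Matrix.one_apply, ite_mul, one_mul, zero_mul, Finset.mul_sum]
  refine Finset.sum_congr rfl fun j _ => Finset.sum_congr rfl fun i _ => ?_
  rw [Finset.sum_eq_single j (fun b _ hb => by simp [hb.symm]) (by simp)]
  exact Finset.sum_congr rfl fun i' _ => by rw [if_pos rfl]; ring

lemma dotProduct_diagonal_kronecker_one_mulVec (γ : ℝ) {m n : ℕ} (k x : Fin n × Fin m → ℝ) :
    x ⬝ᵥ (Matrix.diagonal k * (Gmat γ n ⊗ₖ (1 : Matrix (Fin m) (Fin m) ℝ))) *ᵥ x =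
      ∑ i, gForm γ (fun j => k (j, i) * x (j, i)) (fun j => x (j, i)) := by
  simp only [dotProduct, Matrix.mulVec, Matrix.diagonal_mul, Matrix.kroneckerMap_apply,
    Fintype.sum_prod_type, gForm, Finset.mul_sum]
  rw [Finset.sum_comm]
  refine Finset.sum_congr rfl fun i _ => Finset.sum_congr rfl fun j _ =>
    Finset.sum_congr rfl fun j' _ => ?_
  rw [Finset.sum_eq_single i (fun b _ hb => by simp [hb.symm]) (by simp),
    Matrix.one_apply_eq]
  ring

lemma grid_mem_Ioo {a b h : ℝ} (hab : a < b) {m : ℕ} (hh : h = (b - a) / (m + 1)) {j : ℕ}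
    (hj : j < m) : a + ((j : ℝ) + 1) * h ∈ Set.Ioo a b := by
  have hm : (0 : ℝ) < m + 1 := by positivity
  have hpos : 0 < h := hh ▸ div_pos (sub_pos.2 hab) hm
  have hmul : ((m : ℝ) + 1) * h = b - a := by
    rw [hh]
    field_simp
  have hjm : (j : ℝ) + 1 < m + 1 := by exact_mod_cast Nat.succ_lt_succ hj
  exact ⟨by linarith [mul_pos (by positivity : (0 : ℝ) < (j : ℝ) + 1) hpos],
    by linarith [mul_lt_mul_of_pos_right hjm hpos]⟩

/-- Corollary 3.2(ii): if `d > 0`, the ratio `e/d` satisfies slice-wise bounds and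
convexity/concavity in `y`, and `κ^{e'}(x) − √2(κ^{e'}_max(x) − κ^{e'}_min(x))/ς_β ≥ 0`
for every `x`, then `D⁻¹` is symmetric positive definite and the symmetric part of
`D⁻¹·A` is negative semidefinite. -/
theorem Dinv_symmetric_part_negSemidef (α β : ℝ)
    (hα : α ∈ Set.Ioo (1 : ℝ) 2) (hβ : β ∈ Set.Ioo (1 : ℝ) 2)
    (M₁ M₂ : ℕ) (hM₁ : 0 < M₁) (hM₂ : 0 < M₂)
    (xL xR yL yR : ℝ) (hx : xL < xR) (hy : yL < yR)
    (h₁ h₂ : ℝ) (hh₁ : h₁ = (xR - xL) / (M₁ + 1)) (hh₂ : h₂ = (yR - yL) / (M₂ + 1))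
    (d e : ℝ → ℝ → ℝ)
    (hdpos : ∀ x ∈ Set.Ioo xL xR, ∀ y ∈ Set.Ioo yL yR, 0 < d x y)
    (henonneg : ∀ x ∈ Set.Ioo xL xR, ∀ y ∈ Set.Ioo yL yR, 0 ≤ e x y)
    (κmin' κmax' κ' : ℝ → ℝ)
    (hκmin' : ∀ x ∈ Set.Ioo xL xR, 0 ≤ κmin' x)
    (hbound : ∀ x ∈ Set.Ioo xL xR, ∀ y ∈ Set.Ioo yL yR,
      κmin' x ≤ e x y / d x y ∧ e x y / d x y ≤ κmax' x)
    (hκ' : ∀ x ∈ Set.Ioo xL xR,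
      (ConvexOn ℝ (Set.Ioo yL yR) (fun y => e x y / d x y) ∧ κ' x = κmin' x) ∨
      (ConcaveOn ℝ (Set.Ioo yL yR) (fun y => e x y / d x y) ∧ κ' x = κmax' x))
    (hcond : ∀ x ∈ Set.Ioo xL xR,
      0 ≤ κ' x - Real.sqrt 2 * (κmax' x - κmin' x) / |Real.cos (β * Real.pi / 2)|)
    (D E A : Matrix (Fin M₂ × Fin M₁) (Fin M₂ × Fin M₁) ℝ)
    (hD : D = Matrix.diagonal fun p => d (xL + ((p.2 : ℕ) + 1) * h₁) (yL + ((p.1 : ℕ) + 1) * h₂))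
    (hE : E = Matrix.diagonal fun p => e (xL + ((p.2 : ℕ) + 1) * h₁) (yL + ((p.1 : ℕ) + 1) * h₂))
    (hA : A = (1 / (2 * h₁ ^ α)) • (D * ((1 : Matrix (Fin M₂) (Fin M₂) ℝ) ⊗ₖ Gmat α M₁)) +
              (1 / (2 * h₂ ^ β)) • (E * (Gmat β M₂ ⊗ₖ (1 : Matrix (Fin M₁) (Fin M₁) ℝ)))) :
    (D⁻¹).PosDef ∧ (-(((1 : ℝ) / 2) • (D⁻¹ * A + (D⁻¹ * A)ᵀ))).PosSemidef := by
  have hx' := fun (i : Fin M₁) => grid_mem_Ioo hx hh₁ i.2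
  have hy' := fun (j : Fin M₂) => grid_mem_Ioo hy hh₂ j.2
  have hh₁' : 0 ≤ 1 / (2 * h₁ ^ α) := by
    have : 0 ≤ h₁ := hh₁ ▸ div_nonneg (sub_pos.2 hx).le (by positivity)
    positivity
  have hh₂' : 0 ≤ 1 / (2 * h₂ ^ β) := by
    have : 0 ≤ h₂ := hh₂ ▸ div_nonneg (sub_pos.2 hy).le (by positivity)
    positivity
  have hd : ∀ p : Fin M₂ × Fin M₁,
      0 < d (xL + ((p.2 : ℕ) + 1) * h₁) (yL + ((p.1 : ℕ) + 1) * h₂) :=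
    fun p => hdpos _ (hx' p.2) _ (hy' p.1)
  have hDinv : D⁻¹ = Matrix.diagonal fun p =>
      (d (xL + ((p.2 : ℕ) + 1) * h₁) (yL + ((p.1 : ℕ) + 1) * h₂))⁻¹ := by
    refine Matrix.inv_eq_left_inv ?_
    rw [hD, Matrix.diagonal_mul_diagonal, ← Matrix.diagonal_one]
    exact congrArg _ (funext fun p => inv_mul_cancel₀ (hd p).ne')
  refine ⟨?_, posSemidef_neg_symmetric_part fun x => ?_⟩
  · rw [hDinv, Matrix.posDef_diagonal_iff]
    exact fun p => inv_pos.2 (hd p)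
  have hDA : D⁻¹ * A = (1 / (2 * h₁ ^ α)) • ((1 : Matrix (Fin M₂) (Fin M₂) ℝ) ⊗ₖ Gmat α M₁) +
      (1 / (2 * h₂ ^ β)) • (Matrix.diagonal (fun p : Fin M₂ × Fin M₁ =>
        e (xL + ((p.2 : ℕ) + 1) * h₁) (yL + ((p.1 : ℕ) + 1) * h₂) /
          d (xL + ((p.2 : ℕ) + 1) * h₁) (yL + ((p.1 : ℕ) + 1) * h₂)) *
        (Gmat β M₂ ⊗ₖ (1 : Matrix (Fin M₁) (Fin M₁) ℝ))) := by
    have h1 : D⁻¹ * D = 1 := by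
      rw [hDinv, hD, Matrix.diagonal_mul_diagonal, ← Matrix.diagonal_one]
      exact congrArg _ (funext fun p => inv_mul_cancel₀ (hd p).ne')
    rw [hA, Matrix.mul_add, Matrix.mul_smul, Matrix.mul_smul, ← Matrix.mul_assoc, h1,
      Matrix.one_mul, ← Matrix.mul_assoc, hDinv, hE, Matrix.diagonal_mul_diagonal]
    simp_rw [inv_mul_eq_div]
  rw [hDA, Matrix.add_mulVec, dotProduct_add, Matrix.smul_mulVec, Matrix.smul_mulVec,
    dotProduct_smul, dotProduct_smul, dotProduct_one_kronecker_mulVec,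
    dotProduct_diagonal_kronecker_one_mulVec]
  refine add_nonpos (mul_nonpos_of_nonneg_of_nonpos hh₁' ?_)
    (mul_nonpos_of_nonneg_of_nonpos hh₂' ?_)
  · exact Finset.sum_nonpos fun j _ => gForm_self_nonpos hα _
  · exact Finset.sum_nonpos fun i _ => gForm_convex_or_concave_nonpos hβ hM₂
      (fun j hj => grid_mem_Ioo hy hh₂ hj) (hbound _ (hx' i)) (hκ' _ (hx' i)) (hcond _ (hx' i)) _
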